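/- arXiv:1501.03070 — 8 statements merged into one kernel-verified Lean document; each statement's English description precedes it below -/
import Mathlib

section
/- Let A, B ∈ ℝ^{n×n} be polytropes. If A ⊕ B = (A ⊕ B)*, then A ⊙ B = B ⊙ A. -/
namespace TropComm

variable {n : ℕ}

/-- Tropical (min-plus) matrix product: `(A ⊙ B) i j = min_s (A i s + B s j)`. -/
def tropMul [NeZero n] (A B : Fin n → Fin n → ℝ) : Fin n → Fin n → ℝ :=
  fun i j => Finset.univ.inf' Finset.univ_nonempty (fun s => A i s + B s j)

/-- Tropical matrix-vector product: `(A ⊙ x) i = min_j (A i j + x j)`. -/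
def tropMulVec [NeZero n] (A : Fin n → Fin n → ℝ) (x : Fin n → ℝ) : Fin n → ℝ :=
  fun i => Finset.univ.inf' Finset.univ_nonempty (fun j => A i j + x j)

/-- Tropical sum: entrywise minimum. -/
def tropSum (A B : Fin n → Fin n → ℝ) : Fin n → Fin n → ℝ :=
  fun i j => min (A i j) (B i j)

/-- `tropPow A k` is the k-fold tropical product `A^{⊙k}` (with the junk value
`tropPow A 0 = A`; only exponents `k ≥ 1` are ever used). -/
def tropPow [NeZero n] (A : Fin n → Fin n → ℝ) : ℕ → (Fin n → Fin n → ℝ)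
  | 0 => A
  | 1 => A
  | (k + 2) => tropMul A (tropPow A (k + 1))

/-- Kleene star `A* = A ⊕ A^{⊙2} ⊕ ⋯ ⊕ A^{⊙n}`. -/
def kleene [NeZero n] (A : Fin n → Fin n → ℝ) : Fin n → Fin n → ℝ :=
  fun i j => Finset.univ.inf' Finset.univ_nonempty (fun k : Fin n => tropPow A (k.val + 1) i j)

/-- A premetric: zero diagonal, positive off-diagonal entries. -/
def IsPremetric (A : Fin n → Fin n → ℝ) : Prop :=
  (∀ i, A i i = 0) ∧ ∀ i j, i ≠ j → 0 < A i j

/-- A polytrope: a premetric satisfying the triangle inequality. -/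
def IsPolytrope (A : Fin n → Fin n → ℝ) : Prop :=
  IsPremetric A ∧ ∀ i j k, A i j ≤ A i k + A k j


theorem tropSum_comm (A B : Fin n → Fin n → ℝ) : tropSum A B = tropSum B A := by
  funext i j
  exact min_comm _ _

/-- A matrix with zero diagonal that equals its Kleene star satisfies the triangle inequality. -/
theorem le_add_of_eq_kleene [NeZero n] {C : Fin n → Fin n → ℝ} (hC : ∀ i, C i i = 0)
    (h : C = kleene C) (i j k : Fin n) : C i j ≤ C i k + C k j := by
  rcases Nat.lt_or_ge 1 n with hn | hn
  · calc C i j = kleene C i j := congrFun (congrFun h i) j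
      _ ≤ tropPow C 2 i j :=
        Finset.inf'_le (fun k : Fin n => tropPow C (k.val + 1) i j) (Finset.mem_univ (⟨1, hn⟩ : Fin n))
      _ ≤ C i k + C k j := Finset.inf'_le (fun s => C i s + C s j) (Finset.mem_univ k)
  · obtain rfl : i = k := Fin.ext (by omega)
    simp [hC]

/-- If `A ⊕ B` satisfies the triangle inequality and `A`, `B` have zero diagonal,
then `A ⊙ B = A ⊕ B`. -/
theorem tropMul_eq_tropSum [NeZero n] {A B : Fin n → Fin n → ℝ}
    (hA : ∀ i, A i i = 0) (hB : ∀ i, B i i = 0)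
    (h : ∀ i j k, tropSum A B i j ≤ tropSum A B i k + tropSum A B k j) :
    tropMul A B = tropSum A B := by
  funext i j
  apply le_antisymm
  · apply le_min
    · exact (Finset.inf'_le (fun s => A i s + B s j) (Finset.mem_univ j)).trans_eq (by simp [hB])
    · exact (Finset.inf'_le (fun s => A i s + B s j) (Finset.mem_univ i)).trans_eq (by simp [hA])
  · exact Finset.le_inf' _ _ fun s _ =>
      (h i j s).trans (add_le_add (min_le_left _ _) (min_le_right _ _))

/-- If `A`, `B` are polytropes and `A ⊕ B = (A ⊕ B)*`,
then `A ⊙ B = B ⊙ A`. -/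
theorem stmt0 {n : ℕ} [NeZero n] (A B : Fin n → Fin n → ℝ)
    (hA : IsPolytrope A) (hB : IsPolytrope B)
    (h : tropSum A B = kleene (tropSum A B)) :
    tropMul A B = tropMul B A := by
  have hdiag : ∀ i, tropSum A B i i = 0 := fun i => by simp [tropSum, hA.1.1 i, hB.1.1 i]
  have htri := le_add_of_eq_kleene hdiag h
  rw [tropMul_eq_tropSum hA.1.1 hB.1.1 htri,
    tropMul_eq_tropSum hB.1.1 hA.1.1 (by rwa [tropSum_comm B A]), tropSum_comm]

end TropComm
end

section
/- Let A, B ∈ ℝ^{n×n} be polytropes. If A ⊙ B = B ⊙ A, then (A ⊕ B)^{⊙2} = (A ⊕ B)*. -/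
namespace TropComm

variable {n : ℕ}

theorem tropMul_le [NeZero n] (A B : Fin n → Fin n → ℝ) (i s j : Fin n) :
    tropMul A B i j ≤ A i s + B s j :=
  Finset.inf'_le _ (Finset.mem_univ s)

theorem exists_tropMul_eq [NeZero n] (A B : Fin n → Fin n → ℝ) (i j : Fin n) :
    ∃ s, tropMul A B i j = A i s + B s j := by
  obtain ⟨s, -, hs⟩ := Finset.exists_mem_eq_inf' Finset.univ_nonempty (fun s => A i s + B s j)
  exact ⟨s, hs⟩

/-- Left multiplication by `A` does not decrease `A ⊙ B` when `A` satisfies the triangle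
inequality. -/
theorem tropMul_le_add_tropMul [NeZero n] {A : Fin n → Fin n → ℝ} (B : Fin n → Fin n → ℝ)
    (hA : ∀ i j k, A i j ≤ A i k + A k j) (i s j : Fin n) :
    tropMul A B i j ≤ A i s + tropMul A B s j := by
  obtain ⟨t, ht⟩ := exists_tropMul_eq A B s j
  linarith [tropMul_le A B i t j, hA i t s]

/-- For commuting polytropes, `A ⊙ B` is a lower bound for every power of `A ⊕ B`. -/
theorem tropMul_le_tropPow_tropSum [NeZero n] {A B : Fin n → Fin n → ℝ}
    (hA : IsPolytrope A) (hB : IsPolytrope B) (h : tropMul A B = tropMul B A) (k : ℕ)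
    (i j : Fin n) : tropMul A B i j ≤ tropPow (tropSum A B) (k + 1) i j := by
  induction k generalizing i j with
  | zero =>
    refine le_min ?_ ?_
    · linarith [tropMul_le A B i j j, hB.1.1 j]
    · linarith [tropMul_le A B i i j, hA.1.1 i]
  | succ k ih =>
    refine Finset.le_inf' Finset.univ_nonempty _ fun s _ => ?_
    have hs := ih s j
    have h₁ := tropMul_le_add_tropMul B hA.2 i s j
    have h₂ := tropMul_le_add_tropMul A hB.2 i s j
    rw [← h] at h₂
    have h₃ : tropMul A B i j - tropMul A B s j ≤ tropSum A B i s :=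
      le_min (by linarith) (by linarith)
    linarith

theorem tropPow_tropSum_two_le [NeZero n] (A B : Fin n → Fin n → ℝ) (i j : Fin n) :
    tropPow (tropSum A B) 2 i j ≤ tropMul A B i j := by
  refine Finset.le_inf' Finset.univ_nonempty _ fun s _ => ?_
  exact (tropMul_le (tropSum A B) (tropSum A B) i s j).trans
    (add_le_add (min_le_left _ _) (min_le_right _ _))

/-- If `A`, `B` are polytropes and `A ⊙ B = B ⊙ A`,
then `(A ⊕ B)^{⊙2} = (A ⊕ B)*`. -/
theorem stmt1 {n : ℕ} [NeZero n] (A B : Fin n → Fin n → ℝ)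
    (hA : IsPolytrope A) (hB : IsPolytrope B)
    (h : tropMul A B = tropMul B A) :
    tropPow (tropSum A B) 2 = kleene (tropSum A B) := by
  funext i j
  apply le_antisymm
  · refine Finset.le_inf' Finset.univ_nonempty _ fun k _ => ?_
    exact (tropPow_tropSum_two_le A B i j).trans (tropMul_le_tropPow_tropSum hA hB h k i j)
  · by_cases hn : 1 < n
    · exact Finset.inf'_le _ (Finset.mem_univ (⟨1, hn⟩ : Fin n))
    · have hij : ∀ s : Fin n, s = i := fun s => by ext; omega
      have h0 : tropSum A B i i = 0 := by simp [tropSum, hA.1.1, hB.1.1]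
      refine (Finset.inf'_le _ (Finset.mem_univ (0 : Fin n))).trans ?_
      refine Finset.le_inf' Finset.univ_nonempty _ fun s _ => ?_
      simp [tropPow, hij s, hij j, h0]

end TropComm
end

section
/- If n ≥ 2 and A ∈ ℝ^{n×n} is a premetric, then A^{⊙(n−1)} = A*. -/
namespace TropComm

variable {n : ℕ}

/-- Premetrics are entrywise nonnegative. -/
theorem IsPremetric.nonneg {A : Fin n → Fin n → ℝ} (hA : IsPremetric A) (i j : Fin n) :
    0 ≤ A i j := by
  rcases eq_or_ne i j with rfl | h
  · exact (hA.1 i).ge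
  · exact (hA.2 i j h).le

theorem tropPow_add_two [NeZero n] (A : Fin n → Fin n → ℝ) (k : ℕ) :
    tropPow A (k + 2) = tropMul A (tropPow A (k + 1)) := rfl

/-- The powers of a premetric decrease entrywise. -/
theorem IsPremetric.antitone_tropPow [NeZero n] {A : Fin n → Fin n → ℝ} (hA : IsPremetric A)
    (i j : Fin n) : Antitone fun k => tropPow A (k + 1) i j :=
  antitone_nat_of_succ_le fun k => by
    simpa [tropPow_add_two, hA.1] using tropMul_le A (tropPow A (k + 1)) i i j

theorem IsPremetric.tropPow_nonneg [NeZero n] {A : Fin n → Fin n → ℝ} (hA : IsPremetric A)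
    (k : ℕ) (i j : Fin n) : 0 ≤ tropPow A (k + 1) i j := by
  induction k generalizing i with
  | zero => exact hA.nonneg i j
  | succ k ih =>
    obtain ⟨s, hs⟩ := exists_tropMul_eq A (tropPow A (k + 1)) i j
    rw [tropPow_add_two, hs]
    exact add_nonneg (hA.nonneg i s) (ih s)

theorem IsPremetric.tropPow_self [NeZero n] {A : Fin n → Fin n → ℝ} (hA : IsPremetric A)
    (k : ℕ) (j : Fin n) : tropPow A (k + 1) j j = 0 :=
  ((hA.antitone_tropPow j j (Nat.zero_le k)).trans (hA.1 j).le).antisymm (hA.tropPow_nonneg k j j)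

/-- If the `(i, j)` entry still drops at the power `k + 2`, then at least `k + 2` indices other
than `j` have an entry in column `j` of that power that is no larger. -/
theorem IsPremetric.le_card_of_tropPow_lt [NeZero n] {A : Fin n → Fin n → ℝ}
    (hA : IsPremetric A) (k : ℕ) (i j : Fin n)
    (h : tropPow A (k + 2) i j < tropPow A (k + 1) i j) :
    k + 2 ≤ (Finset.univ.filter fun s =>
      s ≠ j ∧ tropPow A (k + 2) s j ≤ tropPow A (k + 2) i j).card := by
  induction k generalizing i with
  | zero =>
    obtain ⟨s, hs⟩ := exists_tropMul_eq A (tropPow A 1) i j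
    rw [← tropPow_add_two A 0] at hs
    have hij : i ≠ j := by
      rintro rfl
      simp [hA.tropPow_self 1, hA.tropPow_self 0] at h
    have his : i ≠ s := by
      rintro rfl
      rw [hs, hA.1, zero_add] at h
      exact h.false
    have hsj : s ≠ j := by
      rintro rfl
      rw [hs, hA.tropPow_self 0, add_zero] at h
      exact h.false
    have hle : tropPow A 2 s j ≤ tropPow A 2 i j := by
      have h1 : tropPow A 2 s j ≤ tropPow A 1 s j := hA.antitone_tropPow s j (Nat.zero_le 1)
      have h2 := hA.nonneg i s
      linarith
    refine (Finset.card_pair his).ge.trans (Finset.card_le_card ?_)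
    intro t ht
    rcases Finset.mem_insert.1 ht with rfl | ht
    · simp [hij]
    · rw [Finset.mem_singleton] at ht
      subst ht
      simpa [hsj] using hle
  | succ k ih =>
    obtain ⟨s, hs⟩ := exists_tropMul_eq A (tropPow A (k + 2)) i j
    rw [← tropPow_add_two A (k + 1)] at hs
    have his : i ≠ s := by
      rintro rfl
      rw [hs, hA.1, zero_add] at h
      exact h.false
    have hdrop : tropPow A (k + 2) s j < tropPow A (k + 1) s j := by
      have := tropMul_le A (tropPow A (k + 1)) i s j
      rw [← tropPow_add_two] at this
      linarith
    have hlt : tropPow A (k + 2) s j < tropPow A (k + 3) i j := by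
      linarith [hA.2 i s his]
    have hij : i ≠ j := by
      rintro rfl
      simp [hA.tropPow_self (k + 2), hA.tropPow_self (k + 1)] at h
    refine (Nat.succ_le_succ (ih s hdrop)).trans (Finset.card_lt_card ?_)
    rw [Finset.ssubset_iff_of_subset]
    · refine ⟨i, by simp [hij], ?_⟩
      simp only [Finset.mem_filter, not_and, not_le]
      exact fun _ _ => hlt.trans h
    · intro t ht
      simp only [Finset.mem_filter, Finset.mem_univ, true_and] at ht ⊢
      exact ⟨ht.1, ((hA.antitone_tropPow t j (Nat.le_succ (k + 1))).trans ht.2).trans hlt.le⟩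

/-- The powers of an `n × n` premetric are stationary from exponent `n - 1` to `n`. -/
theorem IsPremetric.tropPow_le_tropPow_succ [NeZero n] {A : Fin n → Fin n → ℝ}
    (hA : IsPremetric A) {k : ℕ} (hk : n ≤ k + 2) (i j : Fin n) :
    tropPow A (k + 1) i j ≤ tropPow A (k + 2) i j := by
  by_contra! h
  refine absurd (hA.le_card_of_tropPow_lt k i j h) (not_le.2 (lt_of_lt_of_le ?_ hk))
  conv_rhs => rw [← Finset.card_fin n]
  exact Finset.card_lt_card
    (Finset.filter_ssubset.2 ⟨j, Finset.mem_univ j, fun hj => hj.1 rfl⟩)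

/-- If `n ≥ 2` and `A` is a premetric, then `A^{⊙(n-1)} = A*`. -/
theorem stmt6 {n : ℕ} [NeZero n] (hn : 2 ≤ n) (A : Fin n → Fin n → ℝ)
    (hA : IsPremetric A) :
    tropPow A (n - 1) = kleene A := by
  obtain ⟨m, rfl⟩ := Nat.exists_eq_add_of_le' hn
  funext i j
  apply le_antisymm
  · refine Finset.le_inf' _ _ fun k _ => ?_
    rcases Nat.lt_or_ge k.val (m + 1) with hk | hk
    · exact hA.antitone_tropPow i j (Nat.le_of_lt_succ hk)
    · rw [show k.val = m + 1 by omega]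
      exact hA.tropPow_le_tropPow_succ le_rfl i j
  · exact Finset.inf'_le (fun k : Fin (m + 2) => tropPow A (k.val + 1) i j)
      (Finset.mem_univ (⟨m, by omega⟩ : Fin (m + 2)))

end TropComm
end

section
/- If A ∈ ℝ^{n×n} is a premetric, then A^{⊙2} = A if and only if A = A*. -/
namespace TropComm

variable {n : ℕ}

/-- A matrix with zero diagonal dominates its tropical square entrywise. -/
theorem tropPow_two_le {n : ℕ} [NeZero n] (A : Fin n → Fin n → ℝ) (hA : ∀ i, A i i = 0)
    (i j : Fin n) : tropPow A 2 i j ≤ A i j := by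
  have h : tropPow A 2 i j ≤ A i j + A j j :=
    Finset.inf'_le (fun s => A i s + A s j) (Finset.mem_univ j)
  rwa [hA j, add_zero] at h

/-- All tropical powers of a tropically idempotent matrix agree with the matrix. -/
theorem tropPow_eq_self {n : ℕ} [NeZero n] (A : Fin n → Fin n → ℝ) (h : tropPow A 2 = A) :
    ∀ k, tropPow A (k + 1) = A
  | 0 => rfl
  | k + 1 => by
    change tropMul A (tropPow A (k + 1)) = A
    rw [tropPow_eq_self A h k]
    exact h

/-- If `A` is a premetric, then `A^{⊙2} = A` iff `A = A*`. -/
theorem stmt7 {n : ℕ} [NeZero n] (A : Fin n → Fin n → ℝ)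
    (hA : IsPremetric A) :
    tropPow A 2 = A ↔ A = kleene A := by
  constructor
  · intro h
    funext i j
    simp only [kleene, tropPow_eq_self A h, Finset.inf'_const]
  · intro h
    funext i j
    refine le_antisymm (tropPow_two_le A hA.1 i j) ?_
    by_cases hn : 1 < n
    · rw [congrFun (congrFun h i) j]
      exact Finset.inf'_le (fun k : Fin n => tropPow A (k.val + 1) i j)
        (Finset.mem_univ (⟨1, hn⟩ : Fin n))
    · have hs : Subsingleton (Fin n) := Fin.subsingleton_iff_le_one.2 (not_lt.1 hn)
      refine Finset.le_inf' Finset.univ_nonempty _ fun s _ => ?_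
      obtain rfl := Subsingleton.elim i j
      obtain rfl := Subsingleton.elim i s
      simp [tropPow, hA.1]

end TropComm
end

section
/- Let n ≥ 3 and let ω^x, ω^y ∈ ℝ^{n×n}. Then the pair (ω^x, ω^y) is balanced if and only if there exist a, b ∈ ℝ and c ∈ ℝⁿ such that ω^x_{ij} = c_i − c_j + a and ω^y_{ij} = c_i − c_j + b for all i, j ∈ [n]. -/
namespace TropComm

/-- The pair `(ωx, ωy)` of weight matrices is *balanced*: for every entry of the
commutator `XY − YX`, all monomials surviving cancellation have equal `ω`-weight.
(i) off-diagonal entries `i ≠ j`; (ii) diagonal entries `i`, where the terms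
`x_{ii} y_{ii}` cancel, so only `s ≠ i` appear. -/
def Balanced {n : ℕ} (ωx ωy : Fin n → Fin n → ℝ) : Prop :=
  (∀ i j, i ≠ j → ∀ s t,
    (ωx i s + ωy s j = ωx i t + ωy t j) ∧ (ωx i s + ωy s j = ωy i s + ωx s j)) ∧
  (∀ i, ∀ s t, s ≠ i → t ≠ i →
    (ωx i s + ωy s i = ωx i t + ωy t i) ∧ (ωx i s + ωy s i = ωy i s + ωx s i))

/-- The difference of a balanced pair is a constant matrix. -/
theorem Balanced.sub_eq_sub {n : ℕ} {ωx ωy : Fin n → Fin n → ℝ} (h : Balanced ωx ωy)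
    (i j k l : Fin n) : ωx i j - ωy i j = ωx k l - ωy k l := by
  have step (i s j : Fin n) : ωx i s - ωy i s = ωx s j - ωy s j := by
    rcases eq_or_ne i j with rfl | hij
    · rcases eq_or_ne s i with rfl | hs
      · rfl
      · linarith [(h.2 i s s hs hs).2]
    · linarith [(h.1 i j hij s s).2]
  rw [step i j k, step j k l]

/-- If `y i s + y s j` does not depend on `s` whenever `i ≠ j`, then `y` is, up to an additive
constant, a matrix of differences. -/
theorem exists_eq_sub_add_of_add_eq_add {n : ℕ} (hn : 3 ≤ n) {y : Fin n → Fin n → ℝ}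
    (h : ∀ i j, i ≠ j → ∀ s t, y i s + y s j = y i t + y t j) :
    ∃ (b : ℝ) (c : Fin n → ℝ), ∀ i j, y i j = c i - c j + b := by
  let o : Fin n := ⟨0, by lia⟩
  have diag (i : Fin n) : y i i = y o o := by
    rcases eq_or_ne i o with hi | hi
    · rw [hi]
    · linarith [h i o hi i o]
  have anti (j k : Fin n) : y j k + y k j = 2 * y o o := by
    rcases eq_or_ne j k with rfl | hjk
    · linarith [diag j]
    · obtain ⟨i, hij, hik⟩ := Fin.exists_ne_and_ne_of_two_lt j k hn
      linarith [h i j hij i k, h i k hik i j, diag i]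
  refine ⟨y o o, fun i => y i o, fun i j => ?_⟩
  rcases eq_or_ne i j with rfl | hij
  · linarith [diag i]
  · linarith [h i j hij i o, diag i, anti o j]

/-- For n ≥ 3, the pair (ωx, ωy) is balanced iff there exist
a, b ∈ ℝ and c ∈ ℝⁿ with ωxᵢⱼ = cᵢ − cⱼ + a and ωyᵢⱼ = cᵢ − cⱼ + b for all i, j. -/
theorem stmt12 {n : ℕ} (hn : 3 ≤ n) (ωx ωy : Fin n → Fin n → ℝ) :
    Balanced ωx ωy ↔
      ∃ (a b : ℝ) (c : Fin n → ℝ), ∀ i j,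
        ωx i j = c i - c j + a ∧ ωy i j = c i - c j + b := by
  constructor
  · intro h
    let o : Fin n := ⟨0, by lia⟩
    have hd (i j : Fin n) := h.sub_eq_sub i j o o
    obtain ⟨b, c, hc⟩ := exists_eq_sub_add_of_add_eq_add hn (y := ωy) fun i j hij s t => by
      linarith [(h.1 i j hij s t).1, hd i s, hd i t]
    exact ⟨b + (ωx o o - ωy o o), b, c, fun i j => ⟨by linarith [hd i j, hc i j], hc i j⟩⟩
  · rintro ⟨a, b, c, h⟩
    have hx (i j : Fin n) := (h i j).1
    have hy (i j : Fin n) := (h i j).2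
    constructor
    · intro i j _ s t
      constructor <;> simp only [hx, hy] <;> ring
    · intro i s t _ _
      constructor <;> simp only [hx, hy] <;> ring

end TropComm
end

section
/- Let A, B ∈ ℝ^{2×2} satisfy A ⊙ B = B ⊙ A and A_{12} + B_{21} = A_{21} + B_{12}. Then (A, B) lies in the 2×2 tropical commuting prevariety; in particular, the minimum of the list (A_{11}+B_{12}, A_{12}+B_{22}, B_{11}+A_{12}, B_{12}+A_{22}) is attained by at least two entries of the list, and the minimum of the list (A_{21}+B_{11}, A_{22}+B_{21}, B_{21}+A_{11}, B_{22}+A_{21}) is attained by at least two entries of the list. -/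
namespace TropComm

variable {n : ℕ}

/-- The minimum of a list of reals is attained at (at least) two distinct positions. -/
def MinTwice (l : List ℝ) : Prop :=
  ∃ i j : Fin l.length, i ≠ j ∧ l.get i = l.get j ∧ ∀ k : Fin l.length, l.get i ≤ l.get k

/-- The 2×2 tropical commuting prevariety: tropicalizations of the three generators
`x₁₂y₂₁ − y₁₂x₂₁`, `(XY−YX)₁₂`, `(XY−YX)₂₁` of the classical 2×2 commuting ideal. -/
def InPrevariety2 (A B : Fin 2 → Fin 2 → ℝ) : Prop :=
  A 0 1 + B 1 0 = B 0 1 + A 1 0 ∧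
  MinTwice [A 0 0 + B 0 1, A 0 1 + B 1 1, B 0 0 + A 0 1, B 0 1 + A 1 1] ∧
  MinTwice [A 1 0 + B 0 0, A 1 1 + B 1 0, B 1 0 + A 0 0, B 1 1 + A 1 0]

theorem tropMul_two (A B : Fin 2 → Fin 2 → ℝ) (i j : Fin 2) :
    tropMul A B i j = min (A i 0 + B 0 j) (A i 1 + B 1 j) := by
  apply le_antisymm
  · exact le_min (Finset.inf'_le _ (Finset.mem_univ 0)) (Finset.inf'_le _ (Finset.mem_univ 1))
  · refine Finset.le_inf' _ _ fun s _ => ?_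
    fin_cases s
    · exact min_le_left _ _
    · exact min_le_right _ _

theorem minTwice_of_min_eq_min {p q r s : ℝ} (h : min p q = min r s) :
    MinTwice [p, q, r, s] := by
  have of_le (i j : Fin 4) (hij : i ≠ j)
      (he : [p, q, r, s].get i = [p, q, r, s].get j)
      (hp : [p, q, r, s].get i ≤ p) (hq : [p, q, r, s].get i ≤ q)
      (hr : [p, q, r, s].get i ≤ r) (hs : [p, q, r, s].get i ≤ s) :
      MinTwice [p, q, r, s] :=
    ⟨i, j, hij, he, fun k => by
      change Fin 4 at k
      fin_cases k
      exacts [hp, hq, hr, hs]⟩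
  rcases le_total p q with hpq | hpq <;> rcases le_total r s with hrs | hrs <;>
    simp only [hpq, hrs, min_eq_left, min_eq_right] at h
  · exact of_le 0 2 (by decide) h le_rfl hpq h.le (h.le.trans hrs)
  · exact of_le 0 3 (by decide) h le_rfl hpq (h.le.trans hrs) h.le
  · exact of_le 1 2 (by decide) h hpq le_rfl h.le (h.le.trans hrs)
  · exact of_le 1 3 (by decide) h hpq le_rfl (h.le.trans hrs) h.le

/-- If `A ⊙ B = B ⊙ A` and `A₁₂ + B₂₁ = A₂₁ + B₁₂`, then `(A, B)`
lies in the 2×2 tropical commuting prevariety; in particular the minima of the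
two displayed lists are each attained at least twice. -/
theorem stmt15 (A B : Fin 2 → Fin 2 → ℝ)
    (hcomm : tropMul A B = tropMul B A)
    (h : A 0 1 + B 1 0 = A 1 0 + B 0 1) :
    InPrevariety2 A B ∧
    MinTwice [A 0 0 + B 0 1, A 0 1 + B 1 1, B 0 0 + A 0 1, B 0 1 + A 1 1] ∧
    MinTwice [A 1 0 + B 0 0, A 1 1 + B 1 0, B 1 0 + A 0 0, B 1 1 + A 1 0] := by
  have entry (i j : Fin 2) := congrFun (congrFun hcomm i) j
  simp only [tropMul_two] at entry
  have h01 := minTwice_of_min_eq_min (entry 0 1)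
  have h10 := minTwice_of_min_eq_min (entry 1 0)
  exact ⟨⟨by linarith, h01, h10⟩, h01, h10⟩

end TropComm
end

section
/- There exist polytropes A, B ∈ ℝ^{4×4} such that A ⊙ B = B ⊙ A but A ⊕ B ≠ (A ⊕ B)*. Hence for n = 4 the implication 'A ⊙ B = B ⊙ A implies A ⊕ B = (A ⊕ B)*' fails for polytropes. -/
namespace TropComm

variable {n : ℕ}

theorem kleene_le_add [NeZero n] (hn : 1 < n) (A : Fin n → Fin n → ℝ) (i s j : Fin n) :
    kleene A i j ≤ A i s + A s j :=
  (Finset.inf'_le (fun k : Fin n => tropPow A (k.val + 1) i j)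
    (Finset.mem_univ (⟨1, hn⟩ : Fin n))).trans
    (Finset.inf'_le (fun s => A i s + A s j) (Finset.mem_univ s))

theorem tropMul_fin_four (A B : Fin 4 → Fin 4 → ℝ) (i j : Fin 4) :
    tropMul A B i j =
      min (A i 0 + B 0 j) (min (A i 1 + B 1 j) (min (A i 2 + B 2 j) (A i 3 + B 3 j))) := by
  refine le_antisymm ?_ ?_
  · simp only [le_min_iff]
    refine ⟨?_, ?_, ?_, ?_⟩ <;>
      exact Finset.inf'_le (fun s => A i s + B s j) (Finset.mem_univ _)
  · refine Finset.le_inf' _ _ fun s _ => ?_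
    fin_cases s <;> simp

/-- There exist 4×4 polytropes with `A ⊙ B = B ⊙ A` but
`A ⊕ B ≠ (A ⊕ B)*`. -/
theorem stmt18 :
    ∃ A B : Fin 4 → Fin 4 → ℝ,
      IsPolytrope A ∧ IsPolytrope B ∧
      tropMul A B = tropMul B A ∧
      tropSum A B ≠ kleene (tropSum A B) := by
  refine ⟨![![0, 3, 3, 3], ![3, 0, 2, 3], ![6, 4, 0, 1], ![5, 3, 3, 0]],
    ![![0, 3, 4, 2], ![4, 0, 6, 4], ![1, 2, 0, 2], ![5, 1, 5, 0]],
    ⟨⟨?_, ?_⟩, ?_⟩, ⟨⟨?_, ?_⟩, ?_⟩, ?_, fun h => ?_⟩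
  · intro i; fin_cases i <;> simp
  · intro i j; fin_cases i <;> fin_cases j <;> simp
  · intro i j k; fin_cases i <;> fin_cases j <;> fin_cases k <;> norm_num
  · intro i; fin_cases i <;> simp
  · intro i j; fin_cases i <;> fin_cases j <;> simp
  · intro i j k; fin_cases i <;> fin_cases j <;> fin_cases k <;> norm_num
  · ext i j
    rw [tropMul_fin_four, tropMul_fin_four]
    fin_cases i <;> fin_cases j <;> simp <;> norm_num
  · -- the path 3 → 1 → 0 of length 1 + 3 beats the direct entry 5
    have hle := (congrFun (congrFun h 3) 0).le.trans (kleene_le_add (by norm_num) _ 3 1 0)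
    simp [tropSum] at hle
    norm_num at hle

end TropComm
end

section
/- There exist polytropes A, B ∈ ℝ^{4×4} such that (A ⊕ B)^{⊙2} = (A ⊕ B)* but A ⊙ B ≠ B ⊙ A. Hence for n = 4 the implication '(A ⊕ B)^{⊙2} = (A ⊕ B)* implies A ⊙ B = B ⊙ A' fails for polytropes. -/
namespace TropComm

variable {n : ℕ}

theorem inf'_univ_fin_four (f : Fin 4 → ℝ) :
    Finset.univ.inf' Finset.univ_nonempty f = min (min (f 0) (f 1)) (min (f 2) (f 3)) := by
  apply le_antisymm
  · simp only [le_min_iff]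
    refine ⟨⟨?_, ?_⟩, ?_, ?_⟩ <;> exact Finset.inf'_le _ (Finset.mem_univ _)
  · refine Finset.le_inf' _ _ fun i _ => ?_
    fin_cases i <;> simp

theorem kleene_eq_tropPow_two {M : Fin 4 → Fin 4 → ℝ} (hle : ∀ i j, tropMul M M i j ≤ M i j)
    (h : tropMul M (tropMul M M) = tropMul M M) : tropPow M 2 = kleene M := by
  funext i j
  simp [kleene, inf'_univ_fin_four, tropPow, h, hle i j]

/-- There exist 4×4 polytropes with `(A ⊕ B)^{⊙2} = (A ⊕ B)*` but
`A ⊙ B ≠ B ⊙ A`. -/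
theorem stmt19 :
    ∃ A B : Fin 4 → Fin 4 → ℝ,
      IsPolytrope A ∧ IsPolytrope B ∧
      tropPow (tropSum A B) 2 = kleene (tropSum A B) ∧
      tropMul A B ≠ tropMul B A := by
  let A : Fin 4 → Fin 4 → ℝ := ![![0, 1, 3, 2], ![2, 0, 2, 2], ![2, 2, 0, 2], ![2, 2, 2, 0]]
  let B : Fin 4 → Fin 4 → ℝ := ![![0, 2, 3, 2], ![2, 0, 1, 2], ![2, 2, 0, 2], ![2, 2, 2, 0]]
  let P : Fin 4 → Fin 4 → ℝ := ![![0, 1, 2, 2], ![2, 0, 1, 2], ![2, 2, 0, 2], ![2, 2, 2, 0]]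
  have hM : tropSum A B = ![![0, 1, 3, 2], ![2, 0, 1, 2], ![2, 2, 0, 2], ![2, 2, 2, 0]] := by
    funext i j
    fin_cases i <;> fin_cases j <;> norm_num [tropSum, A, B]
  have hsq : tropMul (tropSum A B) (tropSum A B) = P := by
    rw [hM]
    funext i j
    fin_cases i <;> fin_cases j <;> simp [tropMul, inf'_univ_fin_four, P] <;> norm_num
  refine ⟨A, B, ⟨⟨?_, ?_⟩, ?_⟩, ⟨⟨?_, ?_⟩, ?_⟩, kleene_eq_tropPow_two ?_ ?_, fun h => ?_⟩
  · intro i; fin_cases i <;> simp [A]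
  · intro i j hij; fin_cases i <;> fin_cases j <;> simp_all [A]
  · intro i j k; fin_cases i <;> fin_cases j <;> fin_cases k <;> norm_num [A]
  · intro i; fin_cases i <;> simp [B]
  · intro i j hij; fin_cases i <;> fin_cases j <;> simp_all [B]
  · intro i j k; fin_cases i <;> fin_cases j <;> fin_cases k <;> norm_num [B]
  · rw [hsq, hM]
    intro i j; fin_cases i <;> fin_cases j <;> norm_num [P]
  · rw [hsq, hM]
    funext i j
    fin_cases i <;> fin_cases j <;> simp [tropMul, inf'_univ_fin_four, P] <;> norm_num
  · have := congrFun (congrFun h 0) 2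
    simp [tropMul, inf'_univ_fin_four, A, B] at this
    norm_num at this

end TropComm
end
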